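/- Up to graph isomorphism, exactly 12 of the connected simple graphs on 6 vertices with a unique perfect matching are non-bipartite and positively invertible. -/

import Mathlib

open Matrix

/-- A simple graph has a unique perfect matching (unique 1-factor) if there is
exactly one perfect matching. -/
def HasUniquePM {V : Type*} (G : SimpleGraph V) : Prop :=
  ∃! M : G.Subgraph, M.IsPerfectMatching

/-- The integer adjacency matrix of a finite simple graph. -/
noncomputable def adjMat {V : Type*} [Fintype V] [DecidableEq V]
    (G : SimpleGraph V) : Matrix V V ℤ :=
  letI := Classical.decRel G.Adj
  G.adjMatrix ℤ

/-- A graph is positively invertible: its adjacency matrix is invertible over `ℤ`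
and some diagonal ±1 matrix `D` makes all entries of `D A⁻¹ D` nonnegative. -/
def PosInvertible {V : Type*} [Fintype V] [DecidableEq V] (G : SimpleGraph V) : Prop :=
  IsUnit (adjMat G) ∧
  ∃ d : V → ℤ, (∀ i, d i = 1 ∨ d i = -1) ∧
    ∀ i j, 0 ≤ (diagonal d * (adjMat G)⁻¹ * diagonal d) i j


/-! ### Encoding of graphs on six vertices by natural numbers -/

/-- Number of the bit that stores the edge `ij`. -/
def bitTable : List (List ℕ) :=
  [[15, 12, 0, 1, 2, 3],
  [12, 15, 4, 5, 6, 7],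
  [0, 4, 15, 13, 8, 9],
  [1, 5, 13, 15, 10, 11],
  [2, 6, 8, 10, 15, 14],
  [3, 7, 9, 11, 14, 15]]

def bitIdx (i j : ℕ) : ℕ := (bitTable.getD i []).getD j 15

def adjN (c i j : ℕ) : Bool := Nat.testBit c (bitIdx i j)

/-- Some permutations preserving the matching `01, 23, 45`. -/
def permList : List (List ℕ) :=
  [[4, 5, 1, 0, 2, 3],
  [1, 0, 2, 3, 4, 5],
  [0, 1, 2, 3, 5, 4],
  [0, 1, 4, 5, 2, 3],
  [4, 5, 2, 3, 0, 1],
  [0, 1, 3, 2, 4, 5],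
  [2, 3, 0, 1, 4, 5],
  [2, 3, 0, 1, 5, 4],
  [1, 0, 4, 5, 2, 3],
  [2, 3, 4, 5, 0, 1]]

/-- The perfect matchings of the complete graph other than `01, 23, 45`. -/
def pmList : List (List ℕ) :=
  [[1, 0, 4, 5, 2, 3],
  [1, 0, 5, 4, 3, 2],
  [2, 3, 0, 1, 5, 4],
  [2, 4, 0, 5, 1, 3],
  [2, 5, 0, 4, 3, 1],
  [3, 2, 1, 0, 5, 4],
  [3, 4, 5, 0, 1, 2],
  [3, 5, 4, 0, 2, 1],
  [4, 2, 1, 5, 0, 3],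
  [4, 3, 5, 1, 0, 2],
  [4, 5, 3, 2, 0, 1],
  [5, 2, 1, 4, 3, 0],
  [5, 3, 4, 1, 2, 0],
  [5, 4, 3, 2, 1, 0]]

def bipList : List (List ℕ) :=
  [[0, 1, 0, 1, 0, 1], [0, 1, 1, 0, 0, 1], [0, 1, 0, 1, 1, 0], [0, 1, 1, 0, 1, 0]]

def discList : List (List ℕ) :=
  [[1, 1, 0, 0, 0, 0], [0, 0, 1, 1, 0, 0], [0, 0, 0, 0, 1, 1]]

/-- Codes of the twelve graphs, with inverse adjacency matrix and signs. -/
def goodData : List (ℕ × List (List ℤ) × List ℤ) :=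
  [(28679, [[0, 1, 0, 0, 0, 0], [1, 2, -1, -1, 0, -1], [0, -1, 0, 1, 0, 0], [0, -1, 1, 0, 0, 0], [0, 0, 0, 0, 0, 1], [0, -1, 0, 0, 1, 0]], [-1, -1, 1, 1, 1, 1]),
   (28687, [[0, 1, 0, 0, 0, 0], [1, 4, -1, -1, -1, -1], [0, -1, 0, 1, 0, 0], [0, -1, 1, 0, 0, 0], [0, -1, 0, 0, 0, 1], [0, -1, 0, 0, 1, 0]], [-1, -1, 1, 1, 1, 1]),
   (28693, [[0, 1, 0, -1, 0, 0], [1, 0, 0, -1, 0, -1], [0, 0, 0, 1, 0, 0], [-1, -1, 1, 2, 0, 1], [0, 0, 0, 0, 0, 1], [0, -1, 0, 1, 1, 0]], [-1, -1, 1, 1, 1, 1]),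
   (28700, [[0, 1, 0, -1, 0, 0], [1, 2, 0, -2, -1, -1], [0, 0, 0, 1, 0, 0], [-1, -2, 1, 2, 1, 1], [0, -1, 0, 1, 0, 1], [0, -1, 0, 1, 1, 0]], [-1, -1, 1, 1, 1, 1]),
   (28701, [[0, 1, 0, -1, 0, 0], [1, 2, 0, -3, -1, -1], [0, 0, 0, 1, 0, 0], [-1, -3, 1, 4, 1, 1], [0, -1, 0, 1, 0, 1], [0, -1, 0, 1, 1, 0]], [-1, -1, 1, 1, 1, 1]),
   (28757, [[0, 1, 0, -1, 0, -1], [1, 0, 0, -1, 0, -1], [0, 0, 0, 1, 0, 0], [-1, -1, 1, 2, 0, 2], [0, 0, 0, 0, 0, 1], [-1, -1, 0, 2, 1, 2]], [-1, -1, 1, 1, 1, 1]),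
   (28935, [[0, 1, 0, 0, 0, 0], [1, 2, -1, -1, 0, 0], [0, -1, 0, 1, 0, 0], [0, -1, 1, 0, 0, -1], [0, 0, 0, 0, 0, 1], [0, 0, 0, -1, 1, 0]], [1, 1, -1, -1, 1, 1]),
   (28956, [[0, 1, 0, -1, 0, 0], [1, 2, 0, -1, -1, -1], [0, 0, 0, 1, 0, 0], [-1, -1, 1, 0, 1, 0], [0, -1, 0, 1, 0, 1], [0, -1, 0, 0, 1, 0]], [-1, -1, 1, 1, 1, 1]),
   (28957, [[0, 1, 0, -1, 0, 0], [1, 2, 0, -2, -1, -1], [0, 0, 0, 1, 0, 0], [-1, -2, 1, 2, 1, 0], [0, -1, 0, 1, 0, 1], [0, -1, 0, 0, 1, 0]], [-1, -1, 1, 1, 1, 1]),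
   (29013, [[0, 1, 0, -1, 0, -1], [1, 0, 0, -1, 0, -1], [0, 0, 0, 1, 0, 0], [-1, -1, 1, 2, 0, 1], [0, 0, 0, 0, 0, 1], [-1, -1, 0, 1, 1, 2]], [-1, -1, 1, 1, 1, 1]),
   (29030, [[0, 1, -1, 0, 0, 0], [1, 0, -1, 0, 0, 0], [-1, -1, 2, 1, 0, 0], [0, 0, 1, 0, 0, -1], [0, 0, 0, 0, 0, 1], [0, 0, 0, -1, 1, 0]], [1, 1, -1, -1, 1, 1]),
   (29455, [[0, 1, 0, 0, 0, 0], [1, 2, -1, -1, 0, 0], [0, -1, 0, 1, 0, 0], [0, -1, 1, 2, -1, -1], [0, 0, 0, -1, 0, 1], [0, 0, 0, -1, 1, 0]], [1, 1, -1, -1, 1, 1])]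

/-- Codes of the other five graphs, with a positive multiple of the inverse and a closed walk. -/
def badData : List (ℕ × ℤ × List (List ℤ) × List (Fin 6)) :=
  [(28732, 3, [[-2, -1, 1, 1, 2, 2], [-1, -2, 2, 2, 1, 1], [1, 2, -2, 1, -1, -1], [1, 2, 1, -2, -1, -1], [2, 1, -1, -1, -2, 1], [2, 1, -1, -1, 1, -2]], [0, 0, 0, 0, 0]),
   (28933, 1, [[0, 1, 0, 0, 0, 0], [1, 0, 0, -1, 0, -1], [0, 0, 0, 1, 0, 0], [0, -1, 1, 0, 0, -1], [0, 0, 0, 0, 0, 1], [0, -1, 0, -1, 1, 0]], [1, 3, 1, 3, 5]),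
   (28938, 1, [[0, 1, 0, 0, 0, 0], [1, -2, -1, 1, -1, 1], [0, -1, 0, 1, 0, 0], [0, 1, 1, 0, 0, -1], [0, -1, 0, 0, 0, 1], [0, 1, 0, -1, 1, 0]], [1, 1, 1, 1, 1]),
   (28939, 1, [[0, 1, 0, 0, 0, 0], [1, 0, -1, 0, -1, 1], [0, -1, 0, 1, 0, 0], [0, 0, 1, 0, 0, -1], [0, -1, 0, 0, 0, 1], [0, 1, 0, -1, 1, 0]], [1, 4, 1, 4, 5]),
   (28943, 1, [[0, 1, 0, 0, 0, 0], [1, 2, -1, 0, -1, 0], [0, -1, 0, 1, 0, 0], [0, 0, 1, 0, 0, -1], [0, -1, 0, 0, 0, 1], [0, 0, 0, -1, 1, 0]], [1, 2, 3, 5, 4])]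

def goodCodes : List ℕ := [28679, 28687, 28693, 28700, 28701, 28757, 28935, 28956, 28957, 29013, 29030, 29455]
def badCodes : List ℕ := [28732, 28933, 28938, 28939, 28943]

def all6 (f : ℕ → Bool) : Bool := f 0 && f 1 && f 2 && f 3 && f 4 && f 5

def otherPM (c : ℕ) : Bool := pmList.any fun l => all6 fun i => adjN c i (l.getD i 0)

def isBip (c : ℕ) : Bool :=
  bipList.any fun l => all6 fun i => all6 fun j => !adjN c i j || !Nat.beq (l.getD i 0) (l.getD j 0)

def isDisc (c : ℕ) : Bool :=
  discList.any fun l => all6 fun i => all6 fun j => !adjN c i j || Nat.beq (l.getD i 0) (l.getD j 0)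

def edgeBit (c : ℕ) (l : List ℕ) (i j : ℕ) : ℕ :=
  bif adjN c i j then Nat.pow 2 (bitIdx (l.getD i 0) (l.getD j 0)) else 0

/-- The code of the permuted graph. -/
def permCode (c : ℕ) (l : List ℕ) : ℕ :=
  28672 + edgeBit c l 0 2 + edgeBit c l 0 3 + edgeBit c l 0 4 + edgeBit c l 0 5
  + edgeBit c l 1 2 + edgeBit c l 1 3 + edgeBit c l 1 4 + edgeBit c l 1 5
  + edgeBit c l 2 4 + edgeBit c l 2 5 + edgeBit c l 3 4 + edgeBit c l 3 5

def isoVia (c cperm : ℕ) (l : List ℕ) : Bool :=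
  all6 fun i => all6 fun j => adjN c i j == adjN cperm (l.getD i 0) (l.getD j 0)

def descends (c : ℕ) : Bool :=
  permList.any fun l => Nat.blt (permCode c l) c && isoVia c (permCode c l) l
    && Nat.ble 28672 (permCode c l)

def chk (c : ℕ) : Bool :=
  otherPM c || isDisc c || isBip c || goodCodes.any (Nat.beq c) || badCodes.any (Nat.beq c)
    || descends c

/-- Binary splitting, so that the kernel recursion stays shallow. -/
def chkAll : ℕ → ℕ → Bool
  | 0, c => chk c
  | n + 1, c => chkAll n (Nat.mul 2 c) && chkAll n (Nat.add (Nat.mul 2 c) 1)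

set_option maxRecDepth 100000 in
theorem chkAll_true : chkAll 12 7 = true := by decide +kernel

theorem chkAll_spec : ∀ (n c : ℕ), chkAll n c = true → ∀ k, k < 2 ^ n → chk (2 ^ n * c + k) = true
  | 0, c, h, k, hk => by
    have : k = 0 := by simpa using hk
    subst this
    simpa [chkAll] using h
  | n + 1, c, h, k, hk => by
    simp only [chkAll, Bool.and_eq_true, Nat.mul_eq, Nat.add_eq] at h
    by_cases hkb : k < 2 ^ n
    · have := chkAll_spec n _ h.1 k hkb
      rwa [← mul_assoc, ← pow_succ] at this
    · have := chkAll_spec n _ h.2 (k - 2 ^ n) (by rw [pow_succ] at hk; omega)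
      have e : 2 ^ n * (2 * c + 1) + (k - 2 ^ n) = 2 ^ (n + 1) * c + k := by
        rw [pow_succ]
        have : 2 ^ n ≤ k := by omega
        zify [this]
        ring
      rwa [e] at this

theorem chk_all (c : ℕ) (h1 : 28672 ≤ c) (h2 : c < 32768) : chk c = true := by
  obtain ⟨k, rfl⟩ := Nat.exists_eq_add_of_le h1
  have e : 28672 = 2 ^ 12 * 7 := by norm_num
  have hk : k < 2 ^ 12 := by norm_num; omega
  rw [e]
  exact chkAll_spec 12 7 chkAll_true k hk

theorem all6_iff (f : ℕ → Bool) : all6 f = true ↔ ∀ i : Fin 6, f i = true := by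
  simp [all6, Fin.forall_fin_succ, and_assoc]

theorem bitIdx_symm : ∀ i j : Fin 6, bitIdx i j = bitIdx j i := by decide

/-- The graph with code `c`. -/
def gr (c : ℕ) : SimpleGraph (Fin 6) where
  Adj i j := i ≠ j ∧ adjN c i j = true
  symm := ⟨by
    rintro i j ⟨h, hadj⟩
    refine ⟨h.symm, ?_⟩
    rw [adjN, bitIdx_symm]
    exact hadj⟩
  loopless := ⟨by
    rintro i ⟨h, _⟩
    exact h rfl⟩

instance (c : ℕ) : DecidableRel (gr c).Adj := fun i j =>
  inferInstanceAs (Decidable (i ≠ j ∧ adjN c i j = true))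

theorem gr_adj (c : ℕ) (i j : Fin 6) : (gr c).Adj i j ↔ i ≠ j ∧ adjN c i j = true := Iff.rfl

/-- Bit number to edge. -/
def bitEdge : List (Fin 6 × Fin 6) :=
  [(0, 2), (0, 3), (0, 4), (0, 5), (1, 2), (1, 3), (1, 4), (1, 5), (2, 4), (2, 5), (3, 4), (3, 5),
    (0, 1), (2, 3), (4, 5)]

theorem bitEdge_spec : ∀ i j : Fin 6, i ≠ j → bitIdx i j < 15 ∧
    (bitEdge.getD (bitIdx i j) (0, 0) = (i, j) ∨ bitEdge.getD (bitIdx i j) (0, 0) = (j, i)) := by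
  decide

theorem exists_code (G : SimpleGraph (Fin 6)) : ∃ c, c < 32768 ∧ G = gr c := by
  classical
  refine ⟨Nat.ofBits (n := 15) fun k =>
    decide (G.Adj (bitEdge.getD k (0, 0)).1 (bitEdge.getD k (0, 0)).2), ?_, ?_⟩
  · exact Nat.ofBits_lt_two_pow _
  · ext i j
    rw [gr_adj]
    by_cases h : i = j
    · subst h; simp
    · obtain ⟨h1, h2⟩ := bitEdge_spec i j h
      rw [adjN, Nat.testBit_ofBits_lt _ _ h1]
      rcases h2 with h2 | h2
      · simp only [h2, ne_eq, h, not_false_eq_true, true_and, decide_eq_true_eq]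
      · simp only [h2, ne_eq, h, not_false_eq_true, true_and, decide_eq_true_eq]
        exact G.adj_comm i j

/-! ### Unique perfect matchings as unique fixed-point free involutions -/

def IsPMFun {V : Type*} (G : SimpleGraph V) (f : V → V) : Prop :=
  ∀ v, f (f v) = v ∧ G.Adj v (f v)

def pmSub {V : Type*} (G : SimpleGraph V) (f : V → V) (hf : IsPMFun G f) : G.Subgraph where
  verts := Set.univ
  Adj a b := f a = b
  adj_sub := by
    rintro a b rfl
    exact (hf a).2
  edge_vert := fun _ => Set.mem_univ _
  symm := ⟨by
    rintro a b rfl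
    exact (hf a).1⟩

theorem pmSub_pm {V : Type*} (G : SimpleGraph V) (f : V → V) (hf : IsPMFun G f) :
    (pmSub G f hf).IsPerfectMatching := by
  rw [SimpleGraph.Subgraph.isPerfectMatching_iff]
  intro v
  exact ⟨f v, rfl, fun w hw => Eq.symm hw⟩

theorem exists_fun {V : Type*} (G : SimpleGraph V) (M : G.Subgraph) (hM : M.IsPerfectMatching) :
    ∃ f, IsPMFun G f ∧ ∀ a b, M.Adj a b ↔ f a = b := by
  have h := SimpleGraph.Subgraph.isPerfectMatching_iff.1 hM
  choose f hf hu using h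
  refine ⟨f, fun v => ⟨?_, M.adj_sub (hf v)⟩, fun a b => ⟨fun h => (hu a b h).symm, ?_⟩⟩
  · exact (hu (f v) v (hf v).symm).symm
  · rintro rfl
    exact hf a

theorem upm_iff {V : Type*} (G : SimpleGraph V) : HasUniquePM G ↔ ∃! f, IsPMFun G f := by
  constructor
  · rintro ⟨M, hM, hu⟩
    obtain ⟨f, hf, hfM⟩ := exists_fun G M hM
    refine ⟨f, hf, fun g hg => ?_⟩
    have e1 := hu _ (pmSub_pm G f hf)
    have e2 := hu _ (pmSub_pm G g hg)
    have e : pmSub G g hg = pmSub G f hf := e2.trans e1.symm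
    funext v
    have : (pmSub G f hf).Adj v (g v) := by
      rw [← e]
      exact (rfl : g v = g v)
    exact Eq.symm this
  · rintro ⟨f, hf, hu⟩
    refine ⟨pmSub G f hf, pmSub_pm G f hf, fun M hM => ?_⟩
    obtain ⟨g, hg, hgM⟩ := exists_fun G M hM
    have := hu g hg
    subst this
    ext a b
    · exact ⟨fun _ => Set.mem_univ _, fun _ => hM.2 a⟩
    · exact hgM a b

theorem IsPMFun.conj {V W : Type*} {G : SimpleGraph V} {H : SimpleGraph W} (e : G ≃g H)
    {f : V → V} (hf : IsPMFun G f) : IsPMFun H (fun w => e (f (e.symm w))) := by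
  intro w
  refine ⟨by simp [(hf _).1], ?_⟩
  have := e.map_adj_iff.2 (hf (e.symm w)).2
  simpa using this

theorem upm_iso {V W : Type*} {G : SimpleGraph V} {H : SimpleGraph W} (e : G ≃g H)
    (h : HasUniquePM G) : HasUniquePM H := by
  rw [upm_iff] at *
  obtain ⟨f, hf, hu⟩ := h
  refine ⟨_, hf.conj e, fun g hg => ?_⟩
  have := hu _ (hg.conj e.symm)
  funext w
  have := congrFun this (e.symm w)
  simp only [← this]
  simp

/-! ### Positive invertibility -/

theorem adjMat_apply {V : Type*} [Fintype V] [DecidableEq V] (G : SimpleGraph V)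
    [DecidableRel G.Adj] (i j : V) : adjMat G i j = if G.Adj i j then 1 else 0 := by
  simp only [adjMat, SimpleGraph.adjMatrix_apply]
  congr

theorem posInv_iff {V : Type*} [Fintype V] [DecidableEq V] (G : SimpleGraph V) :
    PosInvertible G ↔ ∃ (B : Matrix V V ℤ) (d : V → ℤ), adjMat G * B = 1 ∧
      (∀ i, d i = 1 ∨ d i = -1) ∧ ∀ i j, 0 ≤ d i * B i j * d j := by
  constructor
  · rintro ⟨hu, d, hd, h⟩
    refine ⟨(adjMat G)⁻¹, d, ?_, hd, fun i j => ?_⟩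
    · exact Matrix.mul_nonsing_inv _ ((Matrix.isUnit_iff_isUnit_det _).1 hu)
    · simpa [Matrix.mul_diagonal, Matrix.diagonal_mul] using h i j
  · rintro ⟨B, d, hB, hd, h⟩
    refine ⟨?_, d, hd, fun i j => ?_⟩
    · exact IsUnit.of_mul_eq_one _ hB
    · rw [Matrix.inv_eq_right_inv hB]
      simpa [Matrix.mul_diagonal, Matrix.diagonal_mul] using h i j

theorem adjMat_iso {V W : Type*} [Fintype V] [DecidableEq V] [Fintype W] [DecidableEq W]
    {G : SimpleGraph V} {H : SimpleGraph W} (e : G ≃g H) :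
    adjMat H = (adjMat G).submatrix e.symm e.symm := by
  classical
  ext i j
  simp [adjMat_apply, e.symm.map_adj_iff]

theorem posInv_iso {V W : Type*} [Fintype V] [DecidableEq V] [Fintype W] [DecidableEq W]
    {G : SimpleGraph V} {H : SimpleGraph W} (e : G ≃g H) (h : PosInvertible G) :
    PosInvertible H := by
  rw [posInv_iff] at *
  obtain ⟨B, d, hB, hd, h⟩ := h
  refine ⟨B.submatrix e.symm e.symm, fun w => d (e.symm w), ?_, fun i => hd _, fun i j => h _ _⟩
  rw [adjMat_iso e]
  have := Matrix.submatrix_mul_equiv (adjMat G) B e.symm e.symm.toEquiv e.symm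
  refine Eq.trans this ?_
  rw [hB]
  exact Matrix.submatrix_one_equiv e.symm.toEquiv

/-! ### The invariant: sum of the cubes of the degrees -/

noncomputable def cubeSum (G : SimpleGraph (Fin 6)) : ℤ := ∑ i, (∑ j, adjMat G i j) ^ 3

theorem cubeSum_iso {G H : SimpleGraph (Fin 6)} (e : G ≃g H) : cubeSum H = cubeSum G := by
  unfold cubeSum
  rw [adjMat_iso e]
  rw [← Equiv.sum_comp e.symm.toEquiv (fun i => (∑ j, adjMat G i j) ^ 3)]
  refine Finset.sum_congr rfl fun i _ => ?_
  rw [← Equiv.sum_comp e.symm.toEquiv (fun j => adjMat G (e.symm.toEquiv i) j)]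
  rfl

def cubeN (c : ℕ) : ℤ := ∑ i, (∑ j, if (gr c).Adj i j then 1 else 0) ^ 3

theorem cubeSum_gr (c : ℕ) : cubeSum (gr c) = cubeN c := by
  simp only [cubeSum, cubeN, adjMat_apply]

theorem pairwise_cube : goodCodes.Pairwise fun a b => cubeN a ≠ cubeN b := by decide +kernel

/-! ### The good graphs -/

def fn (l : List ℕ) (i : Fin 6) : Fin 6 := Fin.ofNat 6 (l.getD i 0)

def stdPM : List ℕ := [1, 0, 3, 2, 5, 4]

theorem good_conn_aux : ∀ c ∈ goodCodes, ∀ v : Fin 6, v = 0 ∨ (gr c).Adj 0 v ∨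
    ∃ a, (gr c).Adj 0 a ∧ ((gr c).Adj a v ∨ ∃ b, (gr c).Adj a b ∧ (gr c).Adj b v) := by
  decide +kernel

theorem good_conn (c : ℕ) (hc : c ∈ goodCodes) : (gr c).Connected := by
  rw [SimpleGraph.connected_iff_exists_forall_reachable]
  refine ⟨0, fun v => ?_⟩
  rcases good_conn_aux c hc v with rfl | h | ⟨a, ha, h | ⟨b, hb, h⟩⟩
  · exact SimpleGraph.Reachable.refl _
  · exact h.reachable
  · exact ha.reachable.trans h.reachable
  · exact ha.reachable.trans (hb.reachable.trans h.reachable)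

set_option synthInstance.maxSize 100000 in
set_option synthInstance.maxHeartbeats 400000 in
theorem good_upm_aux : ∀ c ∈ goodCodes, ∀ x0, (gr c).Adj 0 x0 → ∀ x1, (gr c).Adj 1 x1 →
    ∀ x2, (gr c).Adj 2 x2 → ∀ x3, (gr c).Adj 3 x3 → ∀ x4, (gr c).Adj 4 x4 →
    ∀ x5, (gr c).Adj 5 x5 →
    (∀ v : Fin 6, ![x0, x1, x2, x3, x4, x5] (![x0, x1, x2, x3, x4, x5] v) = v) →
    x0 = 1 ∧ x1 = 0 ∧ x2 = 3 ∧ x3 = 2 ∧ x4 = 5 ∧ x5 = 4 := by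
  decide +kernel

theorem good_upm_aux2 : ∀ c ∈ goodCodes, ∀ v, fn stdPM (fn stdPM v) = v ∧
    (gr c).Adj v (fn stdPM v) := by
  decide +kernel

theorem good_upm (c : ℕ) (hc : c ∈ goodCodes) : HasUniquePM (gr c) := by
  rw [upm_iff]
  refine ⟨fn stdPM, good_upm_aux2 c hc, fun f hf => ?_⟩
  have key : ![f 0, f 1, f 2, f 3, f 4, f 5] = f := by
    funext i
    fin_cases i <;> rfl
  have := good_upm_aux c hc _ (hf 0).2 _ (hf 1).2 _ (hf 2).2 _ (hf 3).2 _ (hf 4).2 _ (hf 5).2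
    (by rw [key]; exact fun v => (hf v).1)
  obtain ⟨h0, h1, h2, h3, h4, h5⟩ := this
  funext i
  fin_cases i
  · exact h0
  · exact h1
  · exact h2
  · exact h3
  · exact h4
  · exact h5

theorem good_col_aux : ∀ c ∈ goodCodes, ∀ x0 x1 : Fin 2, ((gr c).Adj 0 1 → x0 ≠ x1) →
    ∀ x2 x3 x4 x5 : Fin 2,
    ∃ i j, (gr c).Adj i j ∧ ![x0, x1, x2, x3, x4, x5] i = ![x0, x1, x2, x3, x4, x5] j := by
  decide +kernel

theorem good_col (c : ℕ) (hc : c ∈ goodCodes) : ¬ (gr c).Colorable 2 := by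
  rintro ⟨f⟩
  have key : ![f 0, f 1, f 2, f 3, f 4, f 5] = f := by
    funext i
    fin_cases i <;> rfl
  obtain ⟨i, j, h, e⟩ := good_col_aux c hc (f 0) (f 1) (fun h => f.valid h) (f 2) (f 3) (f 4) (f 5)
  rw [key] at e
  exact f.valid h e

def matOf (l : List (List ℤ)) : Matrix (Fin 6) (Fin 6) ℤ :=
  fun i j => (l.getD i []).getD j 0

def adjZ (c : ℕ) : Matrix (Fin 6) (Fin 6) ℤ := fun i j => if (gr c).Adj i j then 1 else 0

theorem adjMat_gr (c : ℕ) : adjMat (gr c) = adjZ c := by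
  ext i j
  rw [adjMat_apply, adjZ]

theorem good_inv_aux : ∀ x ∈ goodData,
    (∀ i j, ∑ k, adjZ x.1 i k * matOf x.2.1 k j = if i = j then 1 else 0) ∧
    (∀ i : Fin 6, x.2.2.getD i 0 = 1 ∨ x.2.2.getD i 0 = -1) ∧
    ∀ i j : Fin 6, 0 ≤ x.2.2.getD i 0 * matOf x.2.1 i j * x.2.2.getD j 0 := by
  decide +kernel

theorem good_data : ∀ c ∈ goodCodes, ∃ x ∈ goodData, x.1 = c := by decide +kernel

theorem good_inv (c : ℕ) (hc : c ∈ goodCodes) : PosInvertible (gr c) := by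
  obtain ⟨x, hx, rfl⟩ := good_data c hc
  obtain ⟨h1, h2, h3⟩ := good_inv_aux x hx
  rw [posInv_iff]
  refine ⟨matOf x.2.1, fun i => x.2.2.getD i 0, ?_, h2, h3⟩
  rw [adjMat_gr]
  ext i j
  rw [Matrix.mul_apply, h1, Matrix.one_apply]

/-! ### The bad graphs -/

theorem bad_inv_aux : ∀ x ∈ badData, 0 < x.2.1 ∧
    (∀ i j, ∑ k, matOf x.2.2.1 i k * adjZ x.1 k j = if i = j then x.2.1 else 0) ∧
    ∃ i j k l m : Fin 6, x.2.2.2 = [i, j, k, l, m] ∧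
    matOf x.2.2.1 i j * matOf x.2.2.1 j k * matOf x.2.2.1 k l * matOf x.2.2.1 l m *
      matOf x.2.2.1 m i < 0 := by
  decide +kernel

theorem bad_data : ∀ c ∈ badCodes, ∃ x ∈ badData, x.1 = c := by decide +kernel

theorem bad_inv (c : ℕ) (hc : c ∈ badCodes) : ¬ PosInvertible (gr c) := by
  obtain ⟨x, hx, rfl⟩ := bad_data c hc
  obtain ⟨h1, h2, i, j, k, l, m, -, hneg⟩ := bad_inv_aux x hx
  rw [posInv_iff]
  rintro ⟨B, d, hB, hd, h⟩
  rw [adjMat_gr] at hB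
  set C := matOf x.2.2.1 with hC
  have hCA : C * adjZ x.1 = x.2.1 • (1 : Matrix (Fin 6) (Fin 6) ℤ) := by
    ext i j
    rw [Matrix.mul_apply, h2, Matrix.smul_apply, Matrix.one_apply]
    split_ifs <;> simp
  have hCB : C = x.2.1 • B := by
    calc C = C * (adjZ x.1 * B) := by rw [hB, mul_one]
      _ = x.2.1 • B := by rw [← mul_assoc, hCA, smul_mul_assoc, one_mul]
  have hpos : ∀ i j, 0 ≤ d i * C i j * d j := by
    intro i j
    rw [hCB, Matrix.smul_apply, smul_eq_mul]
    have := mul_nonneg h1.le (h i j)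
    linarith [this, show d i * (x.2.1 * B i j) * d j = x.2.1 * (d i * B i j * d j) by ring]
  have hsq : ∀ i, d i * d i = 1 := by
    intro i
    rcases hd i with h | h <;> rw [h] <;> norm_num
  have hprod := mul_nonneg (mul_nonneg (mul_nonneg (mul_nonneg (hpos i j) (hpos j k)) (hpos k l))
    (hpos l m)) (hpos m i)
  have e : d i * C i j * d j * (d j * C j k * d k) * (d k * C k l * d l) * (d l * C l m * d m) *
      (d m * C m i * d i) = (d i * d i) * (d j * d j) * (d k * d k) * (d l * d l) * (d m * d m) *
      (C i j * C j k * C k l * C l m * C m i) := by ring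
  rw [e, hsq, hsq, hsq, hsq, hsq] at hprod
  linarith

/-! ### Consequences of the check -/

theorem pmList_spec : ∀ l ∈ pmList, (∀ v, fn l (fn l v) = v ∧ v ≠ fn l v ∧
    (fn l v : ℕ) = l.getD v 0) ∧ fn l ≠ fn stdPM := by
  decide +kernel

theorem stdPM_spec : ∀ v, fn stdPM (fn stdPM v) = v := by decide

theorem otherPM_spec (c : ℕ) (hc : ∀ v, (gr c).Adj v (fn stdPM v)) (h : otherPM c = true) :
    ¬ HasUniquePM (gr c) := by
  rw [upm_iff]
  intro hu
  simp only [otherPM, List.any_eq_true] at h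
  obtain ⟨l, hl, h⟩ := h
  rw [all6_iff] at h
  obtain ⟨h1, h2⟩ := pmList_spec l hl
  refine h2 (hu.unique (fun v => ⟨(h1 v).1, (gr_adj _ _ _).2 ⟨(h1 v).2.1, ?_⟩⟩)
    (fun v => ⟨stdPM_spec v, hc v⟩))
  rw [(h1 v).2.2]
  exact h v

theorem isBip_spec (c : ℕ) (h : isBip c = true) : (gr c).Colorable 2 := by
  simp only [isBip, List.any_eq_true] at h
  obtain ⟨l, hl, h⟩ := h
  simp only [all6_iff] at h
  have hlt : ∀ l ∈ bipList, ∀ i : Fin 6, l.getD i 0 < 2 := by decide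
  refine ⟨SimpleGraph.Coloring.mk (fun i => ⟨l.getD i 0, hlt l hl i⟩) ?_⟩
  intro i j hij e
  have := h i j
  rw [((gr_adj _ _ _).1 hij).2, Fin.mk.inj_iff.1 e, Nat.beq_refl] at this
  exact absurd this (by decide)

theorem isDisc_spec (c : ℕ) (h : isDisc c = true) : ¬ (gr c).Connected := by
  simp only [isDisc, List.any_eq_true] at h
  obtain ⟨l, hl, h⟩ := h
  simp only [all6_iff] at h
  have hlt : ∀ l ∈ discList, ∃ i j : Fin 6, l.getD i 0 ≠ l.getD j 0 := by decide
  obtain ⟨i, j, hij⟩ := hlt l hl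
  intro hc
  obtain ⟨w⟩ := hc.preconnected i j
  apply hij
  clear hij
  induction w with
  | nil => rfl
  | @cons u v w hadj _ ih =>
    rw [← ih]
    have := h u v
    rw [((gr_adj _ _ _).1 hadj).2, Bool.not_true, Bool.false_or] at this
    exact Nat.eq_of_beq_eq_true this

theorem permList_spec : ∀ l ∈ permList, (∀ v, (fn l v : ℕ) = l.getD v 0) ∧
    (∀ v w, fn l v = fn l w → v = w) := by
  decide +kernel

theorem descends_spec (c : ℕ) (h : descends c = true) :
    ∃ cperm, 28672 ≤ cperm ∧ cperm < c ∧ Nonempty (gr c ≃g gr cperm) := by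
  simp only [descends, List.any_eq_true, Bool.and_eq_true] at h
  obtain ⟨l, hl, ⟨h1, h2⟩, h3⟩ := h
  obtain ⟨h4, h5⟩ := permList_spec l hl
  refine ⟨permCode c l, Nat.le_of_ble_eq_true h3, by simpa [Nat.blt] using h1, ⟨?_⟩⟩
  refine ⟨Equiv.ofBijective (fn l) (Finite.injective_iff_bijective.1 h5), ?_⟩
  intro i j
  simp only [isoVia, all6_iff] at h2
  have := h2 i j
  simp only [beq_iff_eq] at this
  simp only [Equiv.ofBijective_apply, gr_adj, h4, this]
  have hinj : fn l i ≠ fn l j ↔ i ≠ j := not_congr ⟨h5 i j, fun h => by rw [h]⟩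
  rw [hinj]

def goodGraphs : List (SimpleGraph (Fin 6)) := goodCodes.map gr

def Claim (G : SimpleGraph (Fin 6)) : Prop :=
  G.Connected → HasUniquePM G → ¬ G.Colorable 2 → PosInvertible G →
    ∃ H ∈ goodGraphs, Nonempty (G ≃g H)

theorem claim_iso {G H : SimpleGraph (Fin 6)} (e : G ≃g H) (h : Claim H) : Claim G := by
  intro h1 h2 h3 h4
  obtain ⟨K, hK, ⟨eK⟩⟩ := h (e.connected_iff.1 h1) (upm_iso e h2)
    (fun hc => h3 (hc.of_hom e.toHom)) (posInv_iso e h4)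
  exact ⟨K, hK, ⟨e.trans eK⟩⟩

theorem std_bits (c : ℕ) (h1 : 28672 ≤ c) (h2 : c < 32768) :
    ∀ v, (gr c).Adj v (fn stdPM v) := by
  have a : ∀ k, 12 ≤ k → k < 15 → Nat.testBit c k = true := by
    intro k hk hkb
    rw [Nat.testBit_eq_decide_div_mod_eq]
    interval_cases k <;> simp <;> omega
  intro v
  rw [gr_adj]
  have b : ∀ v, v ≠ fn stdPM v ∧ 12 ≤ bitIdx v (fn stdPM v) ∧ bitIdx v (fn stdPM v) < 15 := by
    decide
  exact ⟨(b v).1, a _ (b v).2.1 (b v).2.2⟩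

theorem claim_code (c : ℕ) (h1 : 28672 ≤ c) (h2 : c < 32768) : Claim (gr c) := by
  induction c using Nat.strong_induction_on with
  | _ c ih =>
  have h := chk_all c h1 h2
  simp only [chk, Bool.or_eq_true] at h
  rcases h with ((((h | h) | h) | h) | h) | h
  · exact fun _ hu => absurd hu (otherPM_spec c (std_bits c h1 h2) h)
  · exact fun hu => absurd hu (isDisc_spec c h)
  · exact fun _ _ hu => absurd (isBip_spec c h) hu
  · intro _ _ _ _
    obtain ⟨x, hx, hcx⟩ := List.any_eq_true.1 h
    obtain rfl := Nat.eq_of_beq_eq_true hcx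
    exact ⟨gr c, List.mem_map_of_mem hx, ⟨SimpleGraph.Iso.refl⟩⟩
  · intro _ _ _ hp
    obtain ⟨x, hx, hcx⟩ := List.any_eq_true.1 h
    obtain rfl := Nat.eq_of_beq_eq_true hcx
    exact absurd hp (bad_inv c hx)
  · obtain ⟨cperm, h3, h4, ⟨e⟩⟩ := descends_spec c h
    exact claim_iso e (ih cperm h4 h3 (by omega))

theorem exists_relabel (f : Fin 6 → Fin 6) (hf : ∀ v, f (f v) = v) (hne : ∀ v, f v ≠ v) :
    ∃ σ : Equiv.Perm (Fin 6), f (σ 0) = σ 1 ∧ f (σ 2) = σ 3 ∧ f (σ 4) = σ 5 := by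
  have e1 : ∀ x : Fin 6, ∃ a, a ≠ 0 ∧ a ≠ x := by decide
  have e2 : ∀ x y z : Fin 6, ∃ a, a ≠ 0 ∧ a ≠ x ∧ a ≠ y ∧ a ≠ z := by decide +kernel
  obtain ⟨a, ha0, ha1⟩ := e1 (f 0)
  obtain ⟨b, hb0, hb1, hb2, hb3⟩ := e2 (f 0) a (f a)
  have hinj : Function.Injective ![0, f 0, a, f a, b, f b] := by
    have n0 := hne 0
    have na := hne a
    have nb := hne b
    have i0 := hf 0
    have ia := hf a
    have ib := hf b
    have c1 : f a ≠ 0 := fun h => ha1 (by rw [← h, ia])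
    have c2 : f b ≠ 0 := fun h => hb1 (by rw [← h, ib])
    have c3 : f a ≠ f 0 := fun h => ha0 (by rw [← ia, h, i0])
    have c4 : f b ≠ f 0 := fun h => hb0 (by rw [← ib, h, i0])
    have c5 : f b ≠ a := fun h => hb3 (by rw [← h, ib])
    have c6 : f b ≠ f a := fun h => hb2 (by rw [← ib, h, ia])
    intro i j h
    fin_cases i <;> fin_cases j <;> simp at h ⊢ <;> first | exact absurd h ‹_› | exact absurd h.symm ‹_›
  exact ⟨Equiv.ofBijective _ (Finite.injective_iff_bijective.1 hinj), rfl, rfl, rfl⟩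

theorem claim_all (G : SimpleGraph (Fin 6)) : Claim G := by
  intro h1 h2 h3 h4
  obtain ⟨f, hf, -⟩ := (upm_iff G).1 h2
  obtain ⟨σ, s1, s2, s3⟩ := exists_relabel f (fun v => (hf v).1) (fun v => ((hf v).2.ne).symm)
  have e : G.comap σ ≃g G := SimpleGraph.Iso.comap σ G
  obtain ⟨c, hc, hG⟩ := exists_code (G.comap σ)
  have a1 : (gr c).Adj 0 1 := by
    rw [← hG, SimpleGraph.comap_adj, ← s1]
    exact (hf _).2
  have a2 : (gr c).Adj 2 3 := by
    rw [← hG, SimpleGraph.comap_adj, ← s2]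
    exact (hf _).2
  have a3 : (gr c).Adj 4 5 := by
    rw [← hG, SimpleGraph.comap_adj, ← s3]
    exact (hf _).2
  have hlow : 28672 ≤ c := by
    have b1 : Nat.testBit c 12 = true := a1.2
    have b2 : Nat.testBit c 13 = true := a2.2
    have b3 : Nat.testBit c 14 = true := a3.2
    rw [Nat.testBit_eq_decide_div_mod_eq] at b1 b2 b3
    simp at b1 b2 b3
    omega
  have := claim_code c hlow hc
  rw [← hG] at this
  exact claim_iso e.symm this h1 h2 h3 h4

/-- up to isomorphism, exactly 12 of the connected simple graphs on
6 vertices with a unique perfect matching are non-bipartite and positively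
invertible. -/
theorem stmt12 : ∃ L : List (SimpleGraph (Fin 6)),
    L.length = 12 ∧
    L.Pairwise (fun G H => ¬ Nonempty (G ≃g H)) ∧
    (∀ G ∈ L, G.Connected ∧ HasUniquePM G ∧ ¬ G.Colorable 2 ∧ PosInvertible G) ∧
    (∀ G : SimpleGraph (Fin 6), G.Connected → HasUniquePM G → ¬ G.Colorable 2 →
      PosInvertible G → ∃ H ∈ L, Nonempty (G ≃g H)) := by
  refine ⟨goodGraphs, rfl, ?_, ?_, claim_all⟩
  · rw [goodGraphs, List.pairwise_map]
    refine pairwise_cube.imp ?_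
    rintro a b h ⟨e⟩
    apply h
    rw [← cubeSum_gr, ← cubeSum_gr, cubeSum_iso e]
  · intro G hG
    obtain ⟨c, hc, rfl⟩ := List.mem_map.1 hG
    exact ⟨good_conn c hc, good_upm c hc, good_col c hc, good_inv c hc⟩
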